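/- arXiv:1510.02448 — 2 statements merged into one kernel-verified Lean document; each statement's English description precedes it below -/
import Mathlib

section
/- For every real y ≥ 0, the Gaussian gap satisfies log(1+y) − ∫_0^∞ log(1+t·y)·e^{−t} dt ≤ γ, where γ is the Euler–Mascheroni constant. -/
open MeasureTheory

lemma integral_log_mul_exp_neg_Ioi :
    ∫ t in Set.Ioi (0 : ℝ), Real.log t * Real.exp (-t) = -Real.eulerMascheroniConstant := by
  have hΓ : HasDerivAt Complex.GammaIntegral (-Real.eulerMascheroniConstant : ℂ) 1 := by
    refine Complex.hasDerivAt_Gamma_one.congr_of_eventuallyEq ?_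
    have hopen : IsOpen {s : ℂ | 0 < s.re} := isOpen_Ioi.preimage Complex.continuous_re
    filter_upwards [hopen.mem_nhds (by simp : (1 : ℂ) ∈ {s : ℂ | 0 < s.re})] with s hs
      using (Complex.Gamma_eq_integral hs).symm
  have hunique := (Complex.hasDerivAt_GammaIntegral (s := 1) (by simp)).unique hΓ
  simp only [sub_self, Complex.cpow_zero, one_mul, ← Complex.ofReal_mul] at hunique
  rw [integral_complex_ofReal] at hunique
  exact_mod_cast hunique

lemma integrableOn_log_mul_exp_neg_Ioi :
    IntegrableOn (fun t : ℝ => Real.log t * Real.exp (-t)) (Set.Ioi 0) := by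
  refine not_imp_comm.1 integral_undef ?_
  rw [integral_log_mul_exp_neg_Ioi]
  linarith [Real.one_half_lt_eulerMascheroniConstant]

lemma integrableOn_mul_exp_neg_Ioi :
    IntegrableOn (fun t : ℝ => t * Real.exp (-t)) (Set.Ioi 0) := by
  refine (Real.GammaIntegral_convergent (s := 2) two_pos).congr_fun (fun t _ => ?_)
    measurableSet_Ioi
  norm_num [mul_comm]

lemma integral_mul_exp_neg_Ioi : ∫ t in Set.Ioi (0 : ℝ), t * Real.exp (-t) = 1 := by
  rw [← Real.Gamma_two, Real.Gamma_eq_integral two_pos]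
  refine setIntegral_congr_fun measurableSet_Ioi fun t _ => ?_
  norm_num [mul_comm]

lemma integrableOn_log_one_add_mul_mul_exp_neg_Ioi {y : ℝ} (hy : 0 ≤ y) :
    IntegrableOn (fun t : ℝ => Real.log (1 + t * y) * Real.exp (-t)) (Set.Ioi 0) := by
  refine (integrableOn_mul_exp_neg_Ioi.const_mul y).mono'
    (by fun_prop) ((ae_restrict_iff' measurableSet_Ioi).2 (.of_forall fun t ht => ?_))
  have hty : 0 ≤ t * y := mul_nonneg (le_of_lt ht) hy
  rw [Real.norm_of_nonneg (mul_nonneg (Real.log_nonneg (by linarith)) (Real.exp_nonneg _)),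
    ← mul_assoc]
  gcongr
  linarith [Real.log_le_sub_one_of_pos (show 0 < 1 + t * y by linarith)]

/-- The tangent line bound at `t = 1` for the concave function
`t ↦ log (t * (1 + y) / (1 + t * y))`. -/
lemma log_one_add_sub_log_one_add_mul_le {y t : ℝ} (hy : 0 ≤ y) (ht : 0 < t) :
    Real.log (1 + y) - Real.log (1 + t * y) ≤ (t - 1) / (1 + y) - Real.log t := by
  have hy' : 0 < 1 + y := by linarith
  have hty : 0 < 1 + t * y := by positivity
  have hlog := Real.log_le_sub_one_of_pos (show 0 < t * (1 + y) / (1 + t * y) by positivity)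
  rw [Real.log_div (by positivity) hty.ne', Real.log_mul ht.ne' hy'.ne'] at hlog
  have hdiff : (t - 1) / (1 + y) - (t * (1 + y) / (1 + t * y) - 1) =
      y * (t - 1) ^ 2 / ((1 + y) * (1 + t * y)) := by
    field_simp
    ring
  have hnonneg : 0 ≤ y * (t - 1) ^ 2 / ((1 + y) * (1 + t * y)) := by positivity
  linarith

/-- For every real `y ≥ 0`, the Gaussian gap satisfies
`log(1+y) − ∫_0^∞ log(1+t·y)·e^{−t} dt ≤ γ`, where `γ` is the Euler–Mascheroni constant. -/
theorem stmt_5 (y : ℝ) (hy : 0 ≤ y) :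
    Real.log (1 + y) - ∫ t in Set.Ioi (0 : ℝ), Real.log (1 + t * y) * Real.exp (-t)
      ≤ Real.eulerMascheroniConstant := by
  have hexp : IntegrableOn (fun t : ℝ => Real.exp (-t)) (Set.Ioi 0) := integrableOn_exp_neg_Ioi 0
  have hlog := integrableOn_log_one_add_mul_mul_exp_neg_Ioi hy
  have hconst := hexp.const_mul (Real.log (1 + y))
  have hlin : IntegrableOn (fun t : ℝ => (1 + y)⁻¹ * (t * Real.exp (-t) - Real.exp (-t)))
      (Set.Ioi 0) := (integrableOn_mul_exp_neg_Ioi.sub hexp).const_mul (1 + y)⁻¹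
  have hmono : ∫ t in Set.Ioi (0 : ℝ),
        (Real.log (1 + y) * Real.exp (-t) - Real.log (1 + t * y) * Real.exp (-t)) ≤
      ∫ t in Set.Ioi (0 : ℝ), ((1 + y)⁻¹ * (t * Real.exp (-t) - Real.exp (-t)) -
        Real.log t * Real.exp (-t)) := by
    refine setIntegral_mono_on (hconst.sub hlog) (hlin.sub integrableOn_log_mul_exp_neg_Ioi)
      measurableSet_Ioi fun t ht => ?_
    have h := mul_le_mul_of_nonneg_right (log_one_add_sub_log_one_add_mul_le hy ht)
      (Real.exp_nonneg (-t))
    rw [div_eq_inv_mul] at h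
    linarith
  rw [integral_sub hconst hlog, integral_sub hlin integrableOn_log_mul_exp_neg_Ioi,
    integral_const_mul, integral_const_mul, integral_sub integrableOn_mul_exp_neg_Ioi hexp,
    integral_mul_exp_neg_Ioi, integral_exp_neg_Ioi_zero, integral_log_mul_exp_neg_Ioi] at hmono
  linarith
end

section
/- For every integer r ≥ 2, the elliptic gap function g_r : [0,∞) → ℝ defined by g_r(y) = log(1+y) − ∫_0^r log(1+t·y)·(1−1/r)·(1−t/r)^{r−2} dt is monotone nondecreasing on [0,∞). -/
open MeasureTheory

/-- The density `(1−1/r)(1−t/r)^{r−2}` on `[0,r]` has total mass one. -/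
theorem integral_ellipticDensity (r : ℕ) (hr : 2 ≤ r) :
    ∫ t in (0:ℝ)..(r:ℝ), (1 - 1 / (r:ℝ)) * (1 - t / (r:ℝ)) ^ (r - 2) = 1 := by
  obtain ⟨n, rfl⟩ := Nat.exists_eq_add_of_le' hr
  rw [intervalIntegral.integral_eq_sub_of_hasDerivAt
    (f := fun t : ℝ => -(1 - t / ((n + 2 : ℕ) : ℝ)) ^ (n + 1))]
  · simp [-Nat.cast_add]
  · intro t _
    have h := ((((hasDerivAt_id t).div_const ((n + 2 : ℕ) : ℝ)).const_sub 1).pow (n + 1)).neg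
    refine h.congr_deriv ?_
    simp only [id, Nat.add_sub_cancel]
    field_simp
    push_cast
    ring
  · exact Continuous.intervalIntegrable (by fun_prop) _ _

/-- The density `(1−1/r)(1−t/r)^{r−2}` on `[0,r]` has mean one. -/
theorem integral_sub_one_mul_ellipticDensity (r : ℕ) (hr : 2 ≤ r) :
    ∫ t in (0:ℝ)..(r:ℝ), (t - 1) * ((1 - 1 / (r:ℝ)) * (1 - t / (r:ℝ)) ^ (r - 2)) = 0 := by
  obtain ⟨n, rfl⟩ := Nat.exists_eq_add_of_le' hr
  have hr0 : ((n + 2 : ℕ) : ℝ) ≠ 0 := by positivity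
  rw [intervalIntegral.integral_eq_sub_of_hasDerivAt
    (f := fun t : ℝ =>
      (1 - 1 / ((n + 2 : ℕ) : ℝ)) * (-(t * (1 - t / ((n + 2 : ℕ) : ℝ)) ^ (n + 1))))]
  · simp [-Nat.cast_add]
  · intro t _
    have h := (((hasDerivAt_id t).mul
      ((((hasDerivAt_id t).div_const ((n + 2 : ℕ) : ℝ)).const_sub 1).pow (n + 1))).neg).const_mul
      (1 - 1 / ((n + 2 : ℕ) : ℝ))
    refine h.congr_deriv ?_
    simp only [id, Nat.add_sub_cancel, Pi.pow_apply, pow_succ (1 - t / ((n + 2 : ℕ) : ℝ)) n]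
    push_cast at hr0 ⊢
    field_simp
    ring
  · exact Continuous.intervalIntegrable (by fun_prop) _ _

/-- The function `t ↦ log(1+tb) − log(1+ta)` lies below its tangent line at `t = 1`. -/
theorem log_sub_log_le_tangent {a b t : ℝ} (ha : 0 ≤ a) (hab : a ≤ b) (ht : 0 ≤ t) :
    Real.log (1 + t * b) - Real.log (1 + t * a) ≤
      Real.log (1 + b) - Real.log (1 + a) + (b - a) / ((1 + a) * (1 + b)) * (t - 1) := by
  have hb : 0 ≤ b := ha.trans hab
  have h1 : 0 < 1 + t * a := by positivity
  have h2 : 0 < 1 + t * b := by positivity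
  have h3 : 0 < 1 + a := by positivity
  have h4 : 0 < 1 + b := by positivity
  have hlog := Real.log_le_sub_one_of_pos
    (show 0 < ((1 + t * b) * (1 + a)) / ((1 + t * a) * (1 + b)) by positivity)
  rw [Real.log_div (by positivity) (by positivity), Real.log_mul h2.ne' h3.ne',
    Real.log_mul h1.ne' h4.ne'] at hlog
  have hgap : (b - a) / ((1 + a) * (1 + b)) * (t - 1) -
      (((1 + t * b) * (1 + a)) / ((1 + t * a) * (1 + b)) - 1) =
      (b - a) * a * (t - 1) ^ 2 / ((1 + a) * (1 + b) * (1 + t * a)) := by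
    field_simp
    ring
  have hnonneg : 0 ≤ (b - a) * a * (t - 1) ^ 2 / ((1 + a) * (1 + b) * (1 + t * a)) := by
    have := sub_nonneg.mpr hab
    positivity
  linarith

/-- For every integer `r ≥ 2`, the elliptic gap function
`g_r(y) = log(1+y) − ∫_0^r log(1+t·y)·(1−1/r)·(1−t/r)^{r−2} dt`
is monotone nondecreasing on `[0,∞)`. -/
theorem stmt_11 (r : ℕ) (hr : 2 ≤ r) :
    MonotoneOn
      (fun y : ℝ =>
        Real.log (1 + y)
          - ∫ t in (0:ℝ)..(r:ℝ),
              Real.log (1 + t * y) * (1 - 1 / (r:ℝ)) * (1 - t / (r:ℝ)) ^ (r - 2))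
      (Set.Ici (0 : ℝ)) := by
  intro a ha b hb hab
  rw [Set.mem_Ici] at ha hb
  have hr1 : (1:ℝ) ≤ r := by exact_mod_cast (by omega : 1 ≤ r)
  have hint : ∀ y : ℝ, 0 ≤ y → IntervalIntegrable
      (fun t : ℝ => Real.log (1 + t * y) * (1 - 1 / (r:ℝ)) * (1 - t / (r:ℝ)) ^ (r - 2))
      volume 0 r := by
    intro y hy
    apply ContinuousOn.intervalIntegrable
    rw [Set.uIcc_of_le (by positivity)]
    have hlog : ContinuousOn (fun t : ℝ => Real.log (1 + t * y)) (Set.Icc 0 (r:ℝ)) := by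
      refine ContinuousOn.log (by fun_prop) fun t ht => ?_
      have := mul_nonneg ht.1 hy
      positivity
    fun_prop
  set c := Real.log (1 + b) - Real.log (1 + a) with hc
  set s := (b - a) / ((1 + a) * (1 + b)) with hs
  have hint0 : IntervalIntegrable
      (fun t : ℝ => c * ((1 - 1 / (r:ℝ)) * (1 - t / (r:ℝ)) ^ (r - 2))) volume 0 r :=
    Continuous.intervalIntegrable (by fun_prop) _ _
  have hint1 : IntervalIntegrable
      (fun t : ℝ => s * ((t - 1) * ((1 - 1 / (r:ℝ)) * (1 - t / (r:ℝ)) ^ (r - 2)))) volume 0 r :=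
    Continuous.intervalIntegrable (by fun_prop) _ _
  have hle := intervalIntegral.integral_mono_on (Nat.cast_nonneg r)
    ((hint b hb).sub (hint a ha)) (hint0.add hint1) (fun t ht => by
      have hw : 0 ≤ (1 - 1 / (r:ℝ)) * (1 - t / (r:ℝ)) ^ (r - 2) := by
        refine mul_nonneg (sub_nonneg.mpr ?_) (pow_nonneg (sub_nonneg.mpr ?_) _)
        · exact div_le_one_of_le₀ hr1 (by positivity)
        · exact div_le_one_of_le₀ ht.2 (by positivity)
      have := mul_le_mul_of_nonneg_right (log_sub_log_le_tangent ha hab ht.1) hw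
      rw [← hc, ← hs] at this
      linarith)
  rw [intervalIntegral.integral_sub (hint b hb) (hint a ha),
    intervalIntegral.integral_add hint0 hint1, intervalIntegral.integral_const_mul c,
    intervalIntegral.integral_const_mul s, integral_ellipticDensity r hr,
    integral_sub_one_mul_ellipticDensity r hr] at hle
  simp only
  linarith
end
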